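/- For every i ∈ ℤ₇ and every 2-form γ on ℝ⁸, γ∧β_i∧Φ = −3⟨γ, β_i⟩·vol₈. (This is the Hodge-star-free form of the statement that each β_i satisfies ∗₈(β_i∧Φ) = −3β_i, i.e. spin(7)⊥ lies in the −3 eigenspace of the operator ψ ↦ ∗₈(ψ∧Φ).) -/

import Mathlib

open scoped BigOperators RealInnerProductSpace

noncomputable section

abbrev Form (n p : ℕ) := (Fin p → EuclideanSpace ℝ (Fin n)) → ℝ

namespace Form

/-- Wedge product of forms (shuffle convention; full antisymmetrization divided by p!q!). -/
def wedge {n p q : ℕ} (α : Form n p) (β : Form n q) : Form n (p + q) :=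
  fun x =>
    (((p.factorial * q.factorial : ℕ) : ℝ))⁻¹ *
      ∑ σ : Equiv.Perm (Fin (p + q)),
        ((Equiv.Perm.sign σ : ℤ) : ℝ) *
          (α fun i => x (σ (Fin.castAdd q i))) * (β fun j => x (σ (Fin.natAdd p j)))

/-- Inner product of `p`-forms. -/
def inner' {n p : ℕ} (α β : Form n p) : ℝ :=
  ((p.factorial : ℕ) : ℝ)⁻¹ *
    ∑ f : Fin p → Fin n,
      (α fun k => EuclideanSpace.single (f k) 1) * (β fun k => EuclideanSpace.single (f k) 1)

/-- Interior product of a vector and a form. -/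
def iprod {n p : ℕ} (v : EuclideanSpace ℝ (Fin n)) (α : Form n (p + 1)) : Form n p :=
  fun x => α (Fin.cons v x)

end Form

infixl:72 " ⋏ " => Form.wedge

/-- The 1-form dual to a vector. -/
def dual {n : ℕ} (v : EuclideanSpace ℝ (Fin n)) : Form n 1 := fun x => ⟪v, x 0⟫

abbrev E8 := EuclideanSpace ℝ (Fin 8)

/-- The basis vector `e`. -/
def e8 : E8 := EuclideanSpace.single 7 1

/-- The basis vectors `e₀,…,e₆` indexed mod 7. -/
def u7 (i : ZMod 7) : E8 := EuclideanSpace.single ⟨i.val, i.val_lt.trans (by norm_num)⟩ 1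

/-- The basis indexed by ℤ₈, with `e₇ = e`. -/
def u8 (i : ZMod 8) : E8 := EuclideanSpace.single ⟨i.val, i.val_lt⟩ 1

/-- The Spin(7) fundamental 4-form. -/
def Phi (σ : ℝ) : Form 8 4 := fun x =>
  (∑ i : ZMod 7, (dual e8 ⋏ dual (u7 i) ⋏ dual (u7 (i + 1)) ⋏ dual (u7 (i + 3))) x)
    - σ * ∑ i : ZMod 7,
        (dual (u7 (i + 2)) ⋏ dual (u7 (i + 4)) ⋏ dual (u7 (i + 5)) ⋏ dual (u7 (i + 6))) x

/-- The standard volume form of ℝ⁸. -/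
def vol8 : Form 8 8 :=
  dual e8 ⋏ dual (u7 0) ⋏ dual (u7 1) ⋏ dual (u7 2) ⋏ dual (u7 3) ⋏ dual (u7 4) ⋏ dual (u7 5)
    ⋏ dual (u7 6)

/-- The 2-forms spanning spin(7)ᗮ. -/
def beta (σ : ℝ) (i : ZMod 7) : Form 8 2 := fun x =>
  σ * (dual (u7 i) ⋏ dual e8) x + (dual (u7 (i + 1)) ⋏ dual (u7 (i + 3))) x
    + (dual (u7 (i + 4)) ⋏ dual (u7 (i + 5))) x + (dual (u7 (i + 2)) ⋏ dual (u7 (i + 6))) x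

/-- The sign of the permutation sorting a list of natural numbers, or `0` if an entry is repeated. -/
def listSign : List ℕ → ℤ
  | [] => 1
  | a :: l => if a ∈ l then 0 else (l.map fun b => if a < b then 1 else -1).prod * listSign l

theorem listSign_eq_zero {l : List ℕ} (h : ¬ l.Nodup) : listSign l = 0 := by
  induction l with
  | nil => simp at h
  | cons a l ih =>
    rw [listSign]
    split_ifs with ha
    · rfl
    · rw [ih (fun hl => h (List.nodup_cons.2 ⟨ha, hl⟩)), mul_zero]

theorem listSign_ofFn {n : ℕ} {f : Fin n → ℕ} (hf : Function.Injective f) :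
    listSign (List.ofFn f) = ∏ i, ∏ j ∈ Finset.Ioi i, if f i < f j then 1 else -1 := by
  induction n with
  | zero => simp [listSign]
  | succ n ih =>
    have h0 : f 0 ∉ List.ofFn fun i : Fin n => f i.succ := by
      simp only [List.mem_ofFn, not_exists]
      intro i hi
      exact Fin.succ_ne_zero i (hf hi)
    rw [List.ofFn_succ, listSign, if_neg h0,
      ih (f := fun i => f i.succ) (hf.comp (Fin.succ_injective n)),
      Fin.prod_univ_succ, Fin.prod_Ioi_zero, List.map_ofFn, List.prod_ofFn]
    simp [Fin.prod_Ioi_succ]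

namespace Form

variable {n p q : ℕ}

/-- The wedge product as a bilinear map. -/
def wedgeHom (n p q : ℕ) : Form n p →ₗ[ℝ] Form n q →ₗ[ℝ] Form n (p + q) :=
  LinearMap.mk₂ ℝ wedge
    (fun α α' β => by
      funext x
      simp only [wedge, Pi.add_apply, mul_add, add_mul, Finset.sum_add_distrib])
    (fun c α β => by
      funext x
      simp only [wedge, Pi.smul_apply, smul_eq_mul, Finset.mul_sum]
      exact Finset.sum_congr rfl fun _ _ => by ring)
    (fun α β β' => by
      funext x
      simp only [wedge, Pi.add_apply, mul_add, Finset.sum_add_distrib])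
    (fun c α β => by
      funext x
      simp only [wedge, Pi.smul_apply, smul_eq_mul, Finset.mul_sum]
      exact Finset.sum_congr rfl fun _ _ => by ring)

theorem wedge_eq_wedgeHom (α : Form n p) (β : Form n q) : α ⋏ β = wedgeHom n p q α β := rfl

/-- The monomial form `e_{f 0} ∧ ⋯ ∧ e_{f (p - 1)}`. -/
def monomial (f : Fin p → Fin n) : Form n p := fun x => (Matrix.of fun j k => x j (f k)).det

theorem monomial_apply (f : Fin p → Fin n) (x : Fin p → EuclideanSpace ℝ (Fin n)) :
    monomial f x = ∑ τ : Equiv.Perm (Fin p), ((τ.sign : ℤ) : ℝ) * ∏ j, x (τ j) (f j) := by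
  simp [monomial, Matrix.det_apply']

theorem dual_single (a : Fin n) : dual (EuclideanSpace.single a 1) = monomial ![a] := by
  funext x
  simp [dual, monomial, EuclideanSpace.inner_single_left]

theorem monomial_wedge_monomial (f : Fin p → Fin n) (g : Fin q → Fin n) :
    monomial f ⋏ monomial g = monomial (Fin.append f g) := by
  funext x
  have key (τ : Equiv.Perm (Fin p)) (ρ : Equiv.Perm (Fin q)) :
      ∑ σ : Equiv.Perm (Fin (p + q)), ((σ.sign : ℤ) : ℝ) *
        ((((τ.sign : ℤ) : ℝ) * ∏ j, x (σ (Fin.castAdd q (τ j))) (f j)) *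
          (((ρ.sign : ℤ) : ℝ) * ∏ j, x (σ (Fin.natAdd p (ρ j))) (g j))) =
        monomial (Fin.append f g) x := by
    rw [monomial_apply]
    refine Fintype.sum_equiv
      (Equiv.mulRight (finSumFinEquiv.permCongr (Equiv.Perm.sumCongr τ ρ))) _ _ fun σ => ?_
    simp [Fin.prod_univ_add, Equiv.permCongr_apply]
    ring
  have expand (σ : Equiv.Perm (Fin (p + q))) :
      ((σ.sign : ℤ) : ℝ) * (monomial f fun i => x (σ (Fin.castAdd q i))) *
        (monomial g fun j => x (σ (Fin.natAdd p j))) =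
      ∑ τ : Equiv.Perm (Fin p), ∑ ρ : Equiv.Perm (Fin q), ((σ.sign : ℤ) : ℝ) *
        ((((τ.sign : ℤ) : ℝ) * ∏ j, x (σ (Fin.castAdd q (τ j))) (f j)) *
          (((ρ.sign : ℤ) : ℝ) * ∏ j, x (σ (Fin.natAdd p (ρ j))) (g j))) := by
    rw [monomial_apply, monomial_apply, mul_assoc, Finset.sum_mul_sum]
    simp_rw [Finset.mul_sum]
  have hp : (p.factorial : ℝ) ≠ 0 := by positivity
  have hq : (q.factorial : ℝ) ≠ 0 := by positivity
  rw [wedge, Finset.sum_congr rfl fun σ _ => expand σ, Finset.sum_comm,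
    Finset.sum_congr rfl fun τ _ => Finset.sum_comm]
  simp only [key, Finset.sum_const, Finset.card_univ, Fintype.card_perm, Fintype.card_fin,
    nsmul_eq_mul, Nat.cast_mul]
  field_simp

/-- An alternating map is the combination of monomial forms given by its values on the basis. -/
theorem eq_sum_monomial (γ : AlternatingMap ℝ (EuclideanSpace ℝ (Fin n)) ℝ (Fin p)) :
    (⇑γ : Form n p) = ((p.factorial : ℕ) : ℝ)⁻¹ • ∑ f : Fin p → Fin n,
      γ (fun k => EuclideanSpace.single (f k) 1) • monomial f := by
  funext x
  have expand : γ x = ∑ f : Fin p → Fin n,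
      (∏ j, x j (f j)) * γ fun k => EuclideanSpace.single (f k) 1 := by
    have hx : x = fun j => ∑ a, x j a • EuclideanSpace.single a (1 : ℝ) := by
      funext j
      simpa using ((EuclideanSpace.basisFun (Fin n) ℝ).sum_repr (x j)).symm
    conv_lhs => rw [hx]
    rw [← AlternatingMap.coe_multilinearMap, MultilinearMap.map_sum]
    simp [MultilinearMap.map_smul_univ]
  have key (τ : Equiv.Perm (Fin p)) :
      ∑ f : Fin p → Fin n, γ (fun k => EuclideanSpace.single (f k) 1) *
        (((τ.sign : ℤ) : ℝ) * ∏ j, x (τ j) (f j)) = γ x := by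
    rw [expand]
    refine Fintype.sum_equiv (Equiv.arrowCongr τ (Equiv.refl _)) _ _ fun f => ?_
    have hγ := γ.map_perm (fun k => EuclideanSpace.single (f (τ.symm k)) 1) τ
    have hx : ∏ j, x (τ j) (f j) = ∏ j, x j (f (τ.symm j)) :=
      Fintype.prod_equiv τ _ _ fun j => by simp
    have hτ : ((τ.sign : ℤ) : ℝ) * ((τ.sign : ℤ) : ℝ) = 1 := by
      exact_mod_cast Int.units_coe_mul_self τ.sign
    simp only [Function.comp_def, Equiv.symm_apply_apply, Units.smul_def, zsmul_eq_mul] at hγ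
    simp only [Equiv.arrowCongr_apply, Equiv.coe_refl, Function.comp_apply, id, hx, hγ]
    linear_combination (∏ j, x j (f (τ.symm j))) *
      (γ fun k => EuclideanSpace.single (f (τ.symm k)) 1) * hτ
  have hp : (p.factorial : ℝ) ≠ 0 := by positivity
  simp only [Pi.smul_apply, Finset.sum_apply, smul_eq_mul, monomial_apply, Finset.mul_sum _ _ (γ _)]
  rw [Finset.sum_comm]
  simp only [key, Finset.sum_const, Finset.card_univ, Fintype.card_perm, Fintype.card_fin,
    nsmul_eq_mul]
  field_simp

theorem monomial_eq_listSign_mul (f : Fin n → Fin n) (x : Fin n → EuclideanSpace ℝ (Fin n)) :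
    monomial f x = listSign (List.ofFn fun i => (f i : ℕ)) * monomial id x := by
  by_cases hf : Function.Injective f
  · have hσ : f = Equiv.ofBijective f (Finite.injective_iff_bijective.1 hf) := rfl
    rw [listSign_ofFn (f := fun i => (f i : ℕ)) (Fin.val_injective.comp hf)]
    generalize Equiv.ofBijective f _ = σ at hσ
    subst hσ
    have h := Matrix.det_permute' σ (Matrix.of fun j k => x j k)
    rw [Equiv.Perm.sign_eq_prod_prod_Ioi] at h
    simpa [monomial, Matrix.submatrix, apply_ite] using h
  · rw [listSign_eq_zero (by
      rwa [List.nodup_ofFn, ← Function.comp_def, Fin.val_injective.of_comp_iff]), Int.cast_zero,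
      zero_mul]
    obtain ⟨i, j, hij, hne⟩ := Function.not_injective_iff.1 hf
    exact Matrix.det_zero_of_column_eq hne fun k => by simp [hij]

theorem monomial_wedge_dual {m : ℕ} (f : Fin m → Fin n) (a : Fin n) :
    monomial f ⋏ dual (EuclideanSpace.single a 1) =
      monomial (Fin.snoc f a : Fin (m + 1) → Fin n) := by
  rw [dual_single, monomial_wedge_monomial, Fin.append_right_eq_snoc]
  rfl

theorem dual_wedge_dual (a b : Fin n) :
    dual (EuclideanSpace.single a 1) ⋏ dual (EuclideanSpace.single b 1) = monomial ![a, b] := by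
  rw [dual_single a, monomial_wedge_dual]
  congr 1
  ext k
  fin_cases k <;> rfl

end Form

/-- The coordinate of `u7 i`. -/
def idx7 (i : ZMod 7) : Fin 8 := ⟨i.val, i.val_lt.trans (by norm_num)⟩

theorem u7_eq_single (i : ZMod 7) : u7 i = EuclideanSpace.single (idx7 i) 1 := rfl

open Form in
theorem dual_wedge_four {n : ℕ} (a b c d : Fin n) :
    dual (EuclideanSpace.single a 1) ⋏ dual (EuclideanSpace.single b 1) ⋏
      dual (EuclideanSpace.single c 1) ⋏ dual (EuclideanSpace.single d 1) =
      monomial ![a, b, c, d] := by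
  rw [dual_wedge_dual, monomial_wedge_dual, monomial_wedge_dual]
  congr 1
  ext k
  fin_cases k <;> rfl

open Form in
theorem Phi_eq_sum_monomial (σ : ℝ) : Phi σ = ∑ k : ZMod 7,
    (monomial ![7, idx7 k, idx7 (k + 1), idx7 (k + 3)] -
      σ • monomial ![idx7 (k + 2), idx7 (k + 4), idx7 (k + 5), idx7 (k + 6)]) := by
  funext x
  simp only [Phi, e8, u7_eq_single, dual_wedge_four, Finset.sum_apply, Pi.sub_apply,
    Pi.smul_apply, smul_eq_mul, Finset.sum_sub_distrib, Finset.mul_sum]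

open Form in
theorem beta_eq_sum_monomial (σ : ℝ) (i : ZMod 7) :
    beta σ i = σ • monomial ![idx7 i, 7] + monomial ![idx7 (i + 1), idx7 (i + 3)] +
      monomial ![idx7 (i + 4), idx7 (i + 5)] + monomial ![idx7 (i + 2), idx7 (i + 6)] := by
  funext x
  simp only [beta, e8, u7_eq_single, dual_wedge_dual, Pi.add_apply, Pi.smul_apply, smul_eq_mul]

theorem vol8_eq_neg_monomial (x : Fin 8 → E8) : vol8 x = -Form.monomial id x := by
  have h : vol8 = Form.monomial ![7, 0, 1, 2, 3, 4, 5, 6] := by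
    simp only [vol8, e8, u7_eq_single, Form.dual_wedge_dual, Form.monomial_wedge_dual]
    congr 1
    ext k
    fin_cases k <;> rfl
  have hs : listSign [7, 0, 1, 2, 3, 4, 5, 6] = -1 := by decide
  rw [h, Form.monomial_eq_listSign_mul]
  simp [hs]

/-- The coefficient of `e_a ∧ e_b ∧ e_c ∧ e_d ∧ Phi s` along the volume form. -/
def phiCoeff (s : ℤ) (a b c d : Fin 8) : ℤ :=
  ∑ k : ZMod 7, (listSign [a, b, c, d, 7, idx7 k, idx7 (k + 1), idx7 (k + 3)] -
    s * listSign [a, b, c, d, idx7 (k + 2), idx7 (k + 4), idx7 (k + 5), idx7 (k + 6)])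

/-- The value of `e_c ∧ e_d` at `(e_a, e_b)`. -/
def pairing (a b c d : Fin 8) : ℤ :=
  (if c = a then 1 else 0) * (if d = b then 1 else 0) -
    (if d = a then 1 else 0) * (if c = b then 1 else 0)

theorem monomial_single (a b c d : Fin 8) :
    Form.monomial ![c, d] (fun k => EuclideanSpace.single (![a, b] k) 1) = pairing a b c d := by
  simp [Form.monomial, pairing, Matrix.det_fin_two]
  congr

theorem monomial_wedge_four (a b c d a' b' c' d' : Fin 8) (x : Fin 8 → E8) :
    (Form.monomial ![a, b] ⋏ Form.monomial ![c, d] ⋏ Form.monomial ![a', b', c', d']) x =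
      listSign [a, b, c, d, a', b', c', d'] * Form.monomial id x := by
  rw [Form.monomial_wedge_monomial, Form.monomial_wedge_monomial]
  exact Form.monomial_eq_listSign_mul (n := 8) _ x

open Form in
theorem monomial_wedge_Phi (s : ℤ) (a b c d : Fin 8) (x : Fin 8 → E8) :
    (monomial ![a, b] ⋏ monomial ![c, d] ⋏ Phi s) x = phiCoeff s a b c d * monomial id x := by
  rw [Phi_eq_sum_monomial, wedge_eq_wedgeHom _ (∑ k, _)]
  simp only [map_sum, map_sub, map_smul, ← wedge_eq_wedgeHom]
  simp only [Finset.sum_apply, Pi.sub_apply, Pi.smul_apply, monomial_wedge_four, phiCoeff,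
    Int.cast_sum, Finset.sum_mul, smul_eq_mul]
  refine Finset.sum_congr rfl fun k _ => ?_
  push_cast
  simp
  ring

theorem phiCoeff_eq (s : ℤ) (hs : s = 1 ∨ s = -1) (i : ZMod 7) (a b : Fin 8) :
    s * phiCoeff s a b (idx7 i) 7 + phiCoeff s a b (idx7 (i + 1)) (idx7 (i + 3)) +
        phiCoeff s a b (idx7 (i + 4)) (idx7 (i + 5)) +
        phiCoeff s a b (idx7 (i + 2)) (idx7 (i + 6)) =
      3 * (s * pairing a b (idx7 i) 7 + pairing a b (idx7 (i + 1)) (idx7 (i + 3)) +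
        pairing a b (idx7 (i + 4)) (idx7 (i + 5)) + pairing a b (idx7 (i + 2)) (idx7 (i + 6))) := by
  have h : ∀ s ∈ ({1, -1} : Finset ℤ), ∀ (i : ZMod 7) (a b : Fin 8),
      s * phiCoeff s a b (idx7 i) 7 + phiCoeff s a b (idx7 (i + 1)) (idx7 (i + 3)) +
          phiCoeff s a b (idx7 (i + 4)) (idx7 (i + 5)) +
          phiCoeff s a b (idx7 (i + 2)) (idx7 (i + 6)) =
        3 * (s * pairing a b (idx7 i) 7 + pairing a b (idx7 (i + 1)) (idx7 (i + 3)) +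
          pairing a b (idx7 (i + 4)) (idx7 (i + 5)) +
          pairing a b (idx7 (i + 2)) (idx7 (i + 6))) := by
    decide +kernel
  exact h s (by simpa using hs) i a b

open Form in
theorem monomial_wedge_beta_wedge_Phi (s : ℤ) (hs : s = 1 ∨ s = -1) (i : ZMod 7)
    (f : Fin 2 → Fin 8) (x : Fin 8 → E8) :
    (monomial f ⋏ beta s i ⋏ Phi s) x =
      3 * beta s i (fun k => EuclideanSpace.single (f k) 1) * monomial id x := by
  obtain ⟨a, b, rfl⟩ : ∃ a b, f = ![a, b] := ⟨f 0, f 1, List.ofFn_inj.1 rfl⟩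
  have h := congrArg (fun z : ℤ => (z : ℝ) * monomial id x) (phiCoeff_eq s hs i a b)
  push_cast at h
  rw [beta_eq_sum_monomial, wedge_eq_wedgeHom (_ ⋏ _) (Phi _), wedge_eq_wedgeHom (monomial _) _]
  simp only [map_add, map_smul, LinearMap.add_apply, LinearMap.smul_apply, ← wedge_eq_wedgeHom]
  simp only [Pi.add_apply, Pi.smul_apply, smul_eq_mul, monomial_wedge_Phi, monomial_single]
  linear_combination h

/-- for every `i ∈ ℤ₇` and every 2-form `γ` on ℝ⁸,
`γ∧β_i∧Φ = −3⟨γ,β_i⟩·vol₈`. -/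
theorem stmt3 (σ : ℝ) (hσ : σ = 1 ∨ σ = -1) (i : ZMod 7)
    (γ : AlternatingMap ℝ E8 ℝ (Fin 2)) (x : Fin 8 → E8) :
    ((⇑γ : Form 8 2) ⋏ beta σ i ⋏ Phi σ) x = -3 * Form.inner' (⇑γ : Form 8 2) (beta σ i) * vol8 x := by
  obtain ⟨s, hs, rfl⟩ : ∃ s : ℤ, (s = 1 ∨ s = -1) ∧ (s : ℝ) = σ := by
    rcases hσ with rfl | rfl
    · exact ⟨1, by simp⟩
    · exact ⟨-1, by simp⟩
  refine (congrArg (fun α : Form 8 2 => (α ⋏ beta s i ⋏ Phi s) x)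
    (Form.eq_sum_monomial γ)).trans ?_
  rw [vol8_eq_neg_monomial, Form.wedge_eq_wedgeHom (_ ⋏ _) (Phi _),
    Form.wedge_eq_wedgeHom _ (beta _ _)]
  simp only [map_sum, map_smul, LinearMap.sum_apply, LinearMap.smul_apply,
    ← Form.wedge_eq_wedgeHom]
  simp only [Finset.sum_apply, Pi.smul_apply, smul_eq_mul,
    monomial_wedge_beta_wedge_Phi s hs, Form.inner']
  simp only [Finset.mul_sum, Finset.sum_mul]
  exact Finset.sum_congr rfl fun f _ => by ring
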